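/- Let v, q, s, k be integers with v ≥ 2, q ≥ 2, s ≥ 3, and k ≥ 1. Then K_{vq}(2k, s, ks) ≤ OCAN(ks, 2k, s, v)·(q^{ks} − q^{k(s−2)}·(q^k − 1)). -/

import Mathlib

/-- An anti-ideal of the NRT poset `[m·s]`, whose elements are pairs
`(i, a) : Fin m × Fin s` (block `i`, position `a` within the block, positions
within a block forming a chain): an anti-ideal is an up-closed subset. -/
def IsAntiIdeal (m s : ℕ) (J : Finset (Fin m × Fin s)) : Prop :=
  ∀ i : Fin m, ∀ a b : Fin s, a ≤ b → (i, a) ∈ J → (i, b) ∈ J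

/-- Existence of an ordered covering array `OCA_λ(N; t, m, s, v)`:
an `N × ms` array over an alphabet of size `v`, columns indexed by the NRT poset
`[m·s]`, such that for every anti-ideal `J` of size `t`, every `t`-tuple appears
at least `lam` times as a row of the subarray given by the columns in `J`. -/
def IsOCA (lam N t m s v : ℕ) : Prop :=
  ∃ A : Fin N → Fin m × Fin s → Fin v,
    ∀ J : Finset (Fin m × Fin s), IsAntiIdeal m s J → J.card = t →
      ∀ f : Fin m × Fin s → Fin v,
        lam ≤ (Finset.univ.filter (fun r : Fin N => ∀ c ∈ J, A r c = f c)).card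

/-- The ordered covering array number `OCAN_λ(t, m, s, v)`. -/
noncomputable def OCAN (lam t m s v : ℕ) : ℕ := sInf {N | IsOCA lam N t m s v}

/-- The NRT distance on `Z_q^{ms}` (coordinates indexed by `Fin m × Fin s`,
block `i`, position `a` within block): the cardinality of the ideal of the NRT
poset `[m·s]` generated by the support of `x - y`; a coordinate `(i, a)` lies in
this ideal iff `x` and `y` differ at some `(i, b)` with `a ≤ b`. -/
def nrtDist (m s q : ℕ) (x y : Fin m × Fin s → Fin q) : ℕ :=
  (Finset.univ.filter (fun c : Fin m × Fin s =>
    ∃ b : Fin s, c.2 ≤ b ∧ x (c.1, b) ≠ y (c.1, b))).card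

/-- `nrtK q m s R` is the smallest cardinality of an `R`-covering code of the
NRT space `Z_q^{ms}`. -/
noncomputable def nrtK (q m s R : ℕ) : ℕ :=
  sInf {n | ∃ C : Finset (Fin m × Fin s → Fin q), C.card = n ∧
    ∀ x : Fin m × Fin s → Fin q, ∃ c ∈ C, nrtDist m s q x c ≤ R}

theorem nrtDist_le_of_eqOn_antiIdeal {m s q : ℕ} {x y : Fin m × Fin s → Fin q}
    {J : Finset (Fin m × Fin s)} (hJ : IsAntiIdeal m s J) (h : ∀ c ∈ J, x c = y c) :
    nrtDist m s q x y ≤ m * s - J.card := by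
  have hcard : Jᶜ.card = m * s - J.card := by
    simp [Finset.card_compl]
  rw [← hcard]
  refine Finset.card_le_card fun c hc => ?_
  obtain ⟨b, hb, hne⟩ := (Finset.mem_filter.1 hc).2
  exact Finset.mem_compl.2 fun hcJ => hne (h _ (hJ c.1 c.2 b hb hcJ))

theorem exists_isOCA_one (t m s v : ℕ) : ∃ N, IsOCA 1 N t m s v := by
  refine ⟨Fintype.card (Fin m × Fin s → Fin v), (Fintype.equivFin _).symm, fun J _ _ f => ?_⟩
  refine Finset.card_pos.2 ⟨Fintype.equivFin _ f, ?_⟩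
  simp

/-- A `q`-ary code in which every word agrees with a codeword on an anti-ideal of size `t`
yields, together with an ordered covering array of strength `t`, a `vq`-ary covering code. -/
theorem nrtK_mul_le_OCAN_mul_card {v q m s t : ℕ} (H : Finset (Fin m × Fin s → Fin q))
    (hH : ∀ z : Fin m × Fin s → Fin q, ∃ w ∈ H, ∃ J : Finset (Fin m × Fin s),
      IsAntiIdeal m s J ∧ J.card = t ∧ ∀ c ∈ J, z c = w c) :
    nrtK (v * q) m s (m * s - t) ≤ OCAN 1 t m s v * H.card := by
  classical
  obtain ⟨A, hA⟩ : IsOCA 1 (OCAN 1 t m s v) t m s v := Nat.sInf_mem (exists_isOCA_one t m s v)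
  let C : Finset (Fin m × Fin s → Fin (v * q)) :=
    (Finset.univ ×ˢ H).image fun p c => finProdFinEquiv (A p.1 c, p.2 c)
  have hC : C.card ≤ OCAN 1 t m s v * H.card :=
    Finset.card_image_le.trans (by simp [Finset.card_product])
  refine le_trans (Nat.sInf_le ⟨C, rfl, fun x => ?_⟩) hC
  obtain ⟨w, hw, J, hJ, hJt, hagree⟩ := hH fun c => (finProdFinEquiv.symm (x c)).2
  obtain ⟨r, hr⟩ := Finset.card_pos.1 (hA J hJ hJt fun c => (finProdFinEquiv.symm (x c)).1)
  refine ⟨_, Finset.mem_image.2 ⟨(r, w), by simpa using hw, rfl⟩, ?_⟩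
  refine (nrtDist_le_of_eqOn_antiIdeal hJ fun c hc => ?_).trans_eq (by rw [hJt])
  rw [← Equiv.symm_apply_eq]
  exact Prod.ext ((Finset.mem_filter.1 hr).2 c hc).symm (hagree c hc)

/-- The preimage in `[2k·s]` of a subset of `[2·s]`, the `2k` blocks being split into two
groups of `k`. -/
def blowUp (k : ℕ) {s : ℕ} (P : Finset (Fin 2 × Fin s)) : Finset (Fin (2 * k) × Fin s) :=
  Finset.univ.filter fun c => ((finProdFinEquiv.symm c.1).1, c.2) ∈ P

theorem mem_blowUp {k s : ℕ} {P : Finset (Fin 2 × Fin s)} {c : Fin (2 * k) × Fin s} :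
    c ∈ blowUp k P ↔ ((finProdFinEquiv.symm c.1).1, c.2) ∈ P := by
  simp [blowUp]

theorem isAntiIdeal_blowUp {k s : ℕ} {P : Finset (Fin 2 × Fin s)} (hP : IsAntiIdeal 2 s P) :
    IsAntiIdeal (2 * k) s (blowUp k P) := fun _ a b hab h =>
  mem_blowUp.2 (hP _ a b hab (mem_blowUp.1 h))

theorem card_blowUp (k : ℕ) {s : ℕ} (P : Finset (Fin 2 × Fin s)) :
    (blowUp k P).card = k * P.card := by
  have : (blowUp k P).card = (P ×ˢ (Finset.univ : Finset (Fin k))).card := by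
    refine Finset.card_bij'
      (fun c _ => (((finProdFinEquiv.symm c.1).1, c.2), (finProdFinEquiv.symm c.1).2))
      (fun d _ => (finProdFinEquiv (d.1.1, d.2), d.1.2)) ?_ ?_ ?_ ?_
    · intro c hc
      simpa using mem_blowUp.1 hc
    · intro d hd
      rw [mem_blowUp, Equiv.symm_apply_apply]
      exact (Finset.mem_product.1 hd).1
    · intro c _
      exact Prod.ext (finProdFinEquiv.apply_symm_apply c.1) rfl
    · intro d _
      simp only [Equiv.symm_apply_apply]
  rw [this, Finset.card_product, Finset.card_univ, Fintype.card_fin, mul_comm]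

/-- Both groups of `k` blocks filled with the same `k × s` array, given by its rows. -/
def duplicate {k s q : ℕ} (u : Fin s → Fin k → Fin q) : Fin (2 * k) × Fin s → Fin q :=
  fun c => u c.2 (finProdFinEquiv.symm c.1).2

theorem card_filter_last_ne_or_zero_eq (n : ℕ) {Q : Type*} [Fintype Q] [DecidableEq Q] (o : Q) :
    (Finset.univ.filter fun u : Fin (n + 2) → Q => u (Fin.last _) ≠ o ∨ u 0 = o).card ≤
      Fintype.card Q ^ (n + 2) - Fintype.card Q ^ n * (Fintype.card Q - 1) := by
  have hbad : Fintype.card Q ^ n * (Fintype.card Q - 1) ≤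
      (Finset.univ.filter fun u : Fin (n + 2) → Q => ¬(u (Fin.last _) ≠ o ∨ u 0 = o)).card := by
    have hsrc : ((Finset.univ : Finset (Fin n → Q)) ×ˢ Finset.univ.erase o).card =
        Fintype.card Q ^ n * (Fintype.card Q - 1) := by
      simp [Finset.card_product, Finset.card_erase_of_mem]
    rw [← hsrc]
    refine Finset.card_le_card_of_injOn
      (fun p => Fin.cons (α := fun _ => Q) p.2 (Fin.snoc (α := fun _ => Q) p.1 o)) ?_ ?_
    · intro p hp
      have hp2 : p.2 ≠ o := by simpa using hp
      have hlast : Fin.cons (α := fun _ => Q) p.2 (Fin.snoc (α := fun _ => Q) p.1 o)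
          (Fin.last (n + 1)) = o := by
        rw [← Fin.succ_last, Fin.cons_succ, Fin.snoc_last]
      simp [hlast, hp2]
    · rintro ⟨a, b⟩ _ ⟨a', b'⟩ _ h
      obtain ⟨hb, ha⟩ := Fin.cons_injective2 h
      obtain ⟨ha, -⟩ := Fin.snoc_injective2 ha
      exact Prod.ext ha hb
  have htot := Finset.card_filter_add_card_filter_not (s := Finset.univ)
    fun u : Fin (n + 2) → Q => u (Fin.last _) ≠ o ∨ u 0 = o
  rw [Finset.card_univ, Fintype.card_fun, Fintype.card_fin] at htot
  omega

theorem exists_duplicate_eqOn_antiIdeal {k n q : ℕ} (o : Fin k → Fin q)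
    (z : Fin (2 * k) × Fin (n + 2) → Fin q) :
    ∃ u : Fin (n + 2) → Fin k → Fin q, (u (Fin.last _) ≠ o ∨ u 0 = o) ∧
      ∃ J : Finset (Fin (2 * k) × Fin (n + 2)),
        IsAntiIdeal (2 * k) (n + 2) J ∧ J.card = k * (n + 2) ∧ ∀ c ∈ J, z c = duplicate u c := by
  classical
  let x : Fin 2 → Fin (n + 2) → Fin k → Fin q := fun h a i => z (finProdFinEquiv (h, i), a)
  have hz (c) : z c = x (finProdFinEquiv.symm c.1).1 c.2 (finProdFinEquiv.symm c.1).2 := by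
    simp only [x, Prod.mk.eta, Equiv.apply_symm_apply]
  by_cases htop : ∃ h, x h (Fin.last _) ≠ o
  · obtain ⟨h, hh⟩ := htop
    refine ⟨x h, Or.inl hh, blowUp k ({h} ×ˢ Finset.univ), isAntiIdeal_blowUp ?_, ?_, ?_⟩
    · intro i a b _ hi
      simpa using hi
    · simp [card_blowUp]
    · intro c hc
      have hc : (finProdFinEquiv.symm c.1).1 = h := by
        simpa only [Finset.mem_product, Finset.mem_singleton, Finset.mem_univ, and_true]
          using mem_blowUp.1 hc
      rw [hz, hc]
      rfl
  · push Not at htop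
    have hne : Fin.last (n + 1) ≠ 0 := Fin.last_pos.ne'
    refine ⟨Function.update (x 0) 0 o, Or.inr (Function.update_self ..),
      blowUp k ({0} ×ˢ {0}ᶜ ∪ {1} ×ˢ {Fin.last _}), isAntiIdeal_blowUp ?_, ?_, ?_⟩
    · intro i a b hab hi
      simp only [Finset.mem_union, Finset.mem_product, Finset.mem_singleton,
        Finset.mem_compl] at hi ⊢
      rcases hi with ⟨hi, ha⟩ | ⟨hi, ha⟩
      · exact Or.inl ⟨hi, fun hb => ha (Fin.le_zero_iff.1 (hb ▸ hab))⟩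
      · exact Or.inr ⟨hi, Fin.last_le_iff.1 (ha ▸ hab)⟩
    · rw [card_blowUp, Finset.card_union_of_disjoint]
      · simp [Finset.card_compl]
      · exact Finset.disjoint_product.2 (Or.inl (by simp))
    · intro c hc
      have hc := mem_blowUp.1 hc
      simp only [Finset.mem_union, Finset.mem_product, Finset.mem_singleton,
        Finset.mem_compl] at hc
      rw [hz, duplicate]
      rcases hc with ⟨hi, ha⟩ | ⟨hi, ha⟩
      · rw [hi, Function.update_of_ne ha]
      · rw [hi, ha, Function.update_of_ne hne, htop, htop]

/-- `K_{vq}(2k, s, ks) ≤ OCAN(ks, 2k, s, v)·(q^{ks} - q^{k(s-2)}(q^k - 1))`. -/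
theorem stmt_14 (v q s k : ℕ) (hv : 2 ≤ v) (hq : 2 ≤ q) (hs : 3 ≤ s) (hk : 1 ≤ k) :
    nrtK (v * q) (2 * k) s (k * s) ≤
      OCAN 1 (k * s) (2 * k) s v * (q ^ (k * s) - q ^ (k * (s - 2)) * (q ^ k - 1)) := by
  classical
  obtain ⟨n, rfl⟩ : ∃ n, s = n + 2 := ⟨s - 2, by omega⟩
  let o : Fin k → Fin q := fun _ => ⟨0, by omega⟩
  let U := Finset.univ.filter fun u : Fin (n + 2) → Fin k → Fin q => u (Fin.last _) ≠ o ∨ u 0 = o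
  have hU : (U.image duplicate).card ≤
      q ^ (k * (n + 2)) - q ^ (k * (n + 2 - 2)) * (q ^ k - 1) := by
    simpa [← pow_mul] using Finset.card_image_le.trans (card_filter_last_ne_or_zero_eq n o)
  have hcov : nrtK (v * q) (2 * k) (n + 2) (2 * k * (n + 2) - k * (n + 2)) ≤
      OCAN 1 (k * (n + 2)) (2 * k) (n + 2) v * (U.image duplicate).card := by
    refine nrtK_mul_le_OCAN_mul_card _ fun z => ?_
    obtain ⟨u, hu, hJ⟩ := exists_duplicate_eqOn_antiIdeal o z
    exact ⟨_, Finset.mem_image_of_mem _ (Finset.mem_filter.2 ⟨Finset.mem_univ u, hu⟩), hJ⟩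
  have hR : 2 * k * (n + 2) - k * (n + 2) = k * (n + 2) := by
    rw [mul_assoc, two_mul, Nat.add_sub_cancel]
  rw [hR] at hcov
  exact hcov.trans (Nat.mul_le_mul_left _ hU)
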